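/- arXiv:0804.3651 — 6 statements merged into one kernel-verified Lean document; each statement's English description precedes it below -/
import Mathlib

section
/- Let K be a field, V a finite-dimensional K-vector space, and N : V → V a K-linear endomorphism with N^r = 0 for a natural number r. Then there exists a monodromy filtration for (V, N, r), i.e. an increasing family (V_i)_{i ∈ ℤ} of subspaces of V with V_i ⊆ V_{i+1} for all i, such that V_r = V, V_{-r} = 0, N(V_i) ⊆ V_{i-2} for all i, and for every i ≥ 0 the map induced by N^i is an isomorphism from V_i/V_{i-1} onto V_{-i}/V_{-i-1}. -/
/-- A monodromy filtration for `(V, N, r)`: an increasing family `(F i)_{i ∈ ℤ}` of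
subspaces of `V` such that `F r = V`, `F (-r) = 0`, `N (F i) ⊆ F (i - 2)` for all `i`,
and for every `i ≥ 0` the map induced by `N ^ i` is an isomorphism from
`F i / F (i - 1)` onto `F (-i) / F (-i - 1)` (expressed elementwise: `N ^ i` maps
`F i` into `F (-i)`, the induced map on quotients is injective, and it is surjective). -/
def IsMonodromyFiltration {K V : Type*} [Field K] [AddCommGroup V] [Module K V]
    (N : V →ₗ[K] V) (r : ℕ) (F : ℤ → Submodule K V) : Prop :=
  (∀ i : ℤ, F i ≤ F (i + 1)) ∧
  F (r : ℤ) = ⊤ ∧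
  F (-(r : ℤ)) = ⊥ ∧
  (∀ i : ℤ, (F i).map N ≤ F (i - 2)) ∧
  (∀ i : ℕ,
    (∀ x ∈ F (i : ℤ), (N ^ i) x ∈ F (-(i : ℤ))) ∧
    (∀ x ∈ F (i : ℤ), (N ^ i) x ∈ F (-(i : ℤ) - 1) → x ∈ F ((i : ℤ) - 1)) ∧
    (∀ y ∈ F (-(i : ℤ)), ∃ x ∈ F (i : ℤ), y - (N ^ i) x ∈ F (-(i : ℤ) - 1)))

section MonodromyFiltration

variable {K V : Type*} [Field K] [AddCommGroup V] [Module K V]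

/-- The convolution of the kernel and image filtrations of `N`:
`i ↦ ∑ k, N ^ k (ker N ^ (i + 2 k + 1))`, with negative exponents truncated to `0`. -/
def kerImageConvolution (N : V →ₗ[K] V) (i : ℤ) : Submodule K V :=
  ⨆ k : ℕ, (LinearMap.ker (N ^ (i + 2 * k + 1).toNat)).map (N ^ k)

theorem pow_apply_eq_zero_of_le {N : V →ₗ[K] V} {m n : ℕ} (h : m ≤ n) {z : V}
    (hz : (N ^ m) z = 0) : (N ^ n) z = 0 := by
  rw [← Nat.sub_add_cancel h, pow_add, Module.End.mul_apply, hz, map_zero]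

theorem pow_apply_mem_kerImageConvolution (N : V →ₗ[K] V) (i : ℤ) (k : ℕ) {z : V}
    (hz : (N ^ (i + 2 * k + 1).toNat) z = 0) : (N ^ k) z ∈ kerImageConvolution N i :=
  Submodule.mem_iSup_of_mem k (Submodule.mem_map_of_mem hz)

theorem kerImageConvolution_le {N : V →ₗ[K] V} {i : ℤ} {P : Submodule K V}
    (h : ∀ (k : ℕ) (z : V), (N ^ (i + 2 * k + 1).toNat) z = 0 → (N ^ k) z ∈ P) :
    kerImageConvolution N i ≤ P := by
  refine iSup_le fun k => ?_
  rintro _ ⟨z, hz, rfl⟩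
  exact h k z hz

theorem kerImageConvolution_mono (N : V →ₗ[K] V) : Monotone (kerImageConvolution N) :=
  fun i j hij => kerImageConvolution_le fun k _ hz =>
    pow_apply_mem_kerImageConvolution N j k (pow_apply_eq_zero_of_le (by omega) hz)

theorem ker_pow_le_kerImageConvolution (N : V →ₗ[K] V) (n : ℕ) :
    LinearMap.ker (N ^ n) ≤ kerImageConvolution N ((n : ℤ) - 1) := fun z hz =>
  pow_apply_mem_kerImageConvolution N _ 0 (pow_apply_eq_zero_of_le (by omega) hz)

theorem apply_mem_kerImageConvolution {N : V →ₗ[K] V} {i : ℤ} {x : V}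
    (hx : x ∈ kerImageConvolution N i) : N x ∈ kerImageConvolution N (i - 2) := by
  refine kerImageConvolution_le (P := (kerImageConvolution N (i - 2)).comap N)
    (fun k z hz => ?_) hx
  rw [Submodule.mem_comap, ← Module.End.mul_apply, ← pow_succ']
  exact pow_apply_mem_kerImageConvolution N _ (k + 1)
    (pow_apply_eq_zero_of_le (by omega) hz)

theorem pow_apply_mem_kerImageConvolution_sub {N : V →ₗ[K] V} (n : ℕ) {i : ℤ} {x : V}
    (hx : x ∈ kerImageConvolution N i) :
    (N ^ n) x ∈ kerImageConvolution N (i - 2 * n) := by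
  induction n with
  | zero => simpa using hx
  | succ n ih =>
    rw [pow_succ', Module.End.mul_apply]
    convert apply_mem_kerImageConvolution ih using 2
    push_cast
    ring

theorem kerImageConvolution_neg_le_map (N : V →ₗ[K] V) (n : ℕ) :
    kerImageConvolution N (-(n : ℤ)) ≤ (kerImageConvolution N n).map (N ^ n) := by
  refine kerImageConvolution_le fun k z hz => ?_
  rcases lt_or_ge k n with hk | hk
  · rw [pow_apply_eq_zero_of_le (by omega) hz]
    exact zero_mem _
  · refine ⟨(N ^ (k - n)) z, pow_apply_mem_kerImageConvolution N n (k - n)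
      (pow_apply_eq_zero_of_le (by omega) hz), ?_⟩
    rw [← Module.End.mul_apply, ← pow_add, Nat.add_sub_cancel' hk]

theorem isMonodromyFiltration_kerImageConvolution {N : V →ₗ[K] V} {r : ℕ} (hN : N ^ r = 0) :
    IsMonodromyFiltration N r (kerImageConvolution N) := by
  refine ⟨fun i => kerImageConvolution_mono N (by omega), ?_, ?_, ?_, fun i => ⟨?_, ?_, ?_⟩⟩
  · refine top_le_iff.mp fun x _ => ?_
    refine kerImageConvolution_mono N (by omega) (ker_pow_le_kerImageConvolution N r ?_)
    simp [hN]
  · refine le_bot_iff.mp ((kerImageConvolution_neg_le_map N r).trans ?_)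
    simp [hN]
  · rintro i _ ⟨x, hx, rfl⟩
    exact apply_mem_kerImageConvolution hx
  · intro x hx
    convert pow_apply_mem_kerImageConvolution_sub i hx using 2
    ring
  · intro x _ hx
    obtain ⟨y, hy, hxy⟩ := kerImageConvolution_neg_le_map N (i + 1)
      (kerImageConvolution_mono N (by omega) hx)
    rw [pow_succ, Module.End.mul_apply] at hxy
    have hdiff : x - N y ∈ kerImageConvolution N ((i : ℤ) - 1) :=
      ker_pow_le_kerImageConvolution N i (by rw [LinearMap.mem_ker, map_sub, hxy, sub_self])
    have hNy : N y ∈ kerImageConvolution N ((i : ℤ) - 1) :=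
      kerImageConvolution_mono N (by omega) (apply_mem_kerImageConvolution hy)
    simpa using add_mem hdiff hNy
  · intro y hy
    obtain ⟨x, hx, rfl⟩ := kerImageConvolution_neg_le_map N i hy
    exact ⟨x, hx, by simp⟩

end MonodromyFiltration

/-- Existence of the monodromy filtration for a nilpotent endomorphism with `N ^ r = 0`. -/
theorem exists_monodromyFiltration (K V : Type*) [Field K] [AddCommGroup V] [Module K V]
    [FiniteDimensional K V] (N : V →ₗ[K] V) (r : ℕ) (hN : N ^ r = 0) :
    ∃ F : ℤ → Submodule K V, IsMonodromyFiltration N r F :=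
  ⟨kerImageConvolution N, isMonodromyFiltration_kerImageConvolution hN⟩
end

section
/- Let K be a field, V a finite-dimensional K-vector space, and N : V → V a K-linear endomorphism with N^r = 0 for a natural number r. If (V_i)_{i ∈ ℤ} and (V'_i)_{i ∈ ℤ} are both monodromy filtrations for (V, N, r), then V_i = V'_i for every i ∈ ℤ; i.e. the monodromy filtration is unique. -/
namespace IsMonodromyFiltration

variable {K V : Type*} [Field K] [AddCommGroup V] [Module K V] {N : V →ₗ[K] V} {r : ℕ}
  {F F' : ℤ → Submodule K V}

theorem monotone (hF : IsMonodromyFiltration N r F) : Monotone F :=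
  monotone_int_of_le_succ hF.1

theorem apply_mem (hF : IsMonodromyFiltration N r F) {i : ℤ} {x : V} (hx : x ∈ F i) :
    N x ∈ F (i - 2) :=
  hF.2.2.2.1 i (Submodule.mem_map_of_mem hx)

theorem eq_top (hF : IsMonodromyFiltration N r F) {i : ℤ} (hi : r ≤ i) : F i = ⊤ :=
  top_le_iff.1 (hF.2.1 ▸ hF.monotone hi)

theorem eq_bot (hF : IsMonodromyFiltration N r F) {i : ℤ} (hi : i ≤ -r) : F i = ⊥ :=
  le_bot_iff.1 (hF.2.2.1 ▸ hF.monotone hi)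

theorem ker_pow_succ_le (hF : IsMonodromyFiltration N r F) (m : ℕ) :
    LinearMap.ker (N ^ (m + 1)) ≤ F m := by
  intro x hx
  have descend (d : ℕ) : x ∈ F (m + d) → x ∈ F m := by
    induction d with
    | zero => simp
    | succ d ih =>
      intro h
      have hzero : (N ^ (m + d + 1)) x = 0 := by
        rw [show m + d + 1 = d + (m + 1) by omega, pow_add, Module.End.mul_apply,
          LinearMap.mem_ker.1 hx, map_zero]
      have hmem := (hF.2.2.2.2 (m + d + 1)).2.1 x
        (by convert h using 2; push_cast; ring) (hzero ▸ zero_mem _)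
      exact ih (by convert hmem using 2; push_cast; ring)
  exact descend r (hF.eq_top (i := m + r) (by omega) ▸ Submodule.mem_top)

theorem exists_pow_apply_eq (hF : IsMonodromyFiltration N r F) (i : ℕ) {y : V}
    (hy : y ∈ F (-i)) : ∃ x ∈ F i, (N ^ i) x = y := by
  rcases le_or_gt r i with hi | hi
  · rw [hF.eq_bot (by omega), Submodule.mem_bot] at hy
    exact ⟨0, zero_mem _, by simp [hy]⟩
  · obtain ⟨x, hx, hxy⟩ := (hF.2.2.2.2 i).2.2 y hy
    obtain ⟨z, hz, hzy⟩ := hF.exists_pow_apply_eq (i + 1) (y := y - (N ^ i) x)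
      (by convert hxy using 2; push_cast; ring)
    refine ⟨x + N z, add_mem hx (hF.monotone (by push_cast; omega) (hF.apply_mem hz)), ?_⟩
    rw [map_add, ← Module.End.mul_apply, ← pow_succ, hzy, add_sub_cancel]
termination_by r - i

theorem exists_sub_apply_mem_ker (hF : IsMonodromyFiltration N r F) (i : ℕ) {x : V}
    (hx : x ∈ F i) : ∃ z ∈ F (i + 2 : ℕ), x - N z ∈ LinearMap.ker (N ^ (i + 1)) := by
  have hmem : (N ^ (i + 1)) x ∈ F (-(i + 2 : ℕ)) := by
    rw [pow_succ', Module.End.mul_apply]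
    convert hF.apply_mem ((hF.2.2.2.2 i).1 x hx) using 2
    push_cast; ring
  obtain ⟨z, hz, hzx⟩ := hF.exists_pow_apply_eq (i + 2) hmem
  refine ⟨z, hz, ?_⟩
  rw [LinearMap.mem_ker, map_sub, ← Module.End.mul_apply, ← pow_succ, hzx, sub_self]

theorem le_of_nonneg (hF : IsMonodromyFiltration N r F) (hF' : IsMonodromyFiltration N r F')
    (i : ℕ) : F i ≤ F' i := by
  rcases le_or_gt r i with hi | hi
  · rw [hF'.eq_top (by omega)]
    exact le_top
  · intro x hx
    obtain ⟨z, hz, hxz⟩ := hF.exists_sub_apply_mem_ker i hx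
    have hz' := hF'.apply_mem (hF.le_of_nonneg hF' (i + 2) hz)
    rw [← sub_add_cancel x (N z)]
    exact add_mem (hF'.ker_pow_succ_le i hxz) (by simpa using hz')
termination_by r - i

theorem le (hF : IsMonodromyFiltration N r F) (hF' : IsMonodromyFiltration N r F') :
    F ≤ F' := by
  intro i
  obtain ⟨n, rfl | rfl⟩ := i.eq_nat_or_neg
  · exact hF.le_of_nonneg hF' n
  · intro y hy
    obtain ⟨x, hx, rfl⟩ := hF.exists_pow_apply_eq n hy
    exact (hF'.2.2.2.2 n).1 x (hF.le_of_nonneg hF' n hx)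

end IsMonodromyFiltration

/-- Uniqueness of the monodromy filtration. -/
theorem monodromyFiltration_unique (K V : Type*) [Field K] [AddCommGroup V] [Module K V]
    [FiniteDimensional K V] (N : V →ₗ[K] V) (r : ℕ) (hN : N ^ r = 0)
    (F F' : ℤ → Submodule K V)
    (hF : IsMonodromyFiltration N r F) (hF' : IsMonodromyFiltration N r F') :
    ∀ i : ℤ, F i = F' i := by
  exact fun i => le_antisymm (hF.le hF' i) (hF'.le hF i)
end

section
/- Let K be a field, r a natural number, and for j = 1, 2 let V_j be a finite-dimensional K-vector space with an endomorphism N_j : V_j → V_j satisfying N_j^r = 0, and let ((V_j)_i)_{i ∈ ℤ} be a monodromy filtration for (V_j, N_j, r). Then the family of subspaces ((V_1)_i × (V_2)_i)_{i ∈ ℤ} of V_1 × V_2 is a monodromy filtration for (V_1 × V_2, N_1 × N_2, r), where N_1 × N_2 is the endomorphism acting as N_1 on the first factor and N_2 on the second. In particular the monodromy filtration of a direct sum is the direct sum of the monodromy filtrations. -/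
theorem LinearMap.prodMap_pow {R M M' : Type*} [Semiring R] [AddCommMonoid M] [Module R M]
    [AddCommMonoid M'] [Module R M'] (f : M →ₗ[R] M) (g : M' →ₗ[R] M') (n : ℕ) :
    f.prodMap g ^ n = (f ^ n).prodMap (g ^ n) :=
  (map_pow (LinearMap.prodMapRingHom R M M') (f, g) n).symm

/-- The monodromy filtration of a direct sum is the direct sum of the monodromy
filtrations. -/
theorem monodromyFiltration_prod (K : Type*) [Field K]
    (V₁ V₂ : Type*) [AddCommGroup V₁] [Module K V₁] [FiniteDimensional K V₁]
    [AddCommGroup V₂] [Module K V₂] [FiniteDimensional K V₂]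
    (r : ℕ) (N₁ : V₁ →ₗ[K] V₁) (N₂ : V₂ →ₗ[K] V₂)
    (h₁ : N₁ ^ r = 0) (h₂ : N₂ ^ r = 0)
    (F₁ : ℤ → Submodule K V₁) (F₂ : ℤ → Submodule K V₂)
    (hF₁ : IsMonodromyFiltration N₁ r F₁) (hF₂ : IsMonodromyFiltration N₂ r F₂) :
    IsMonodromyFiltration (N₁.prodMap N₂) r (fun i => (F₁ i).prod (F₂ i)) := by
  obtain ⟨mono₁, top₁, bot₁, map₁, iso₁⟩ := hF₁
  obtain ⟨mono₂, top₂, bot₂, map₂, iso₂⟩ := hF₂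
  refine ⟨fun i => Submodule.prod_mono (mono₁ i) (mono₂ i), ?_, ?_, ?_, fun i => ?_⟩
  · simp only [top₁, top₂, Submodule.prod_top]
  · simp only [bot₁, bot₂, Submodule.prod_bot]
  · rintro i _ ⟨x, hx, rfl⟩
    exact ⟨map₁ i ⟨x.1, hx.1, rfl⟩, map₂ i ⟨x.2, hx.2, rfl⟩⟩
  · obtain ⟨maps₁, inj₁, surj₁⟩ := iso₁ i
    obtain ⟨maps₂, inj₂, surj₂⟩ := iso₂ i
    rw [LinearMap.prodMap_pow]
    refine ⟨fun x hx => ⟨maps₁ x.1 hx.1, maps₂ x.2 hx.2⟩,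
      fun x hx h => ⟨inj₁ x.1 hx.1 h.1, inj₂ x.2 hx.2 h.2⟩, fun y hy => ?_⟩
    obtain ⟨x₁, hx₁, hxy₁⟩ := surj₁ y.1 hy.1
    obtain ⟨x₂, hx₂, hxy₂⟩ := surj₂ y.2 hy.2
    exact ⟨(x₁, x₂), ⟨hx₁, hx₂⟩, hxy₁, hxy₂⟩
end

section
/- Let K be a field, V a finite-dimensional K-vector space, r a natural number, and N : V → V a K-linear endomorphism with N^{r+1} = 0. Then (r+1) · dim_K(range of N^r) ≤ dim_K V. -/
open Module

/-- If `N ^ (r + 1) = 0` and `k ≤ r`, the rank drops by at least `dim (range N^r)` from `N ^ k`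
to `N ^ (k + 1)`, because `range N^r` lies in `ker N ⊓ range N^k`. -/
theorem finrank_range_pow_succ_add_le {K V : Type*} [Field K] [AddCommGroup V] [Module K V]
    [FiniteDimensional K V] {r k : ℕ} {N : V →ₗ[K] V} (hN : N ^ (r + 1) = 0) (hk : k ≤ r) :
    finrank K (LinearMap.range (N ^ (k + 1))) + finrank K (LinearMap.range (N ^ r)) ≤
      finrank K (LinearMap.range (N ^ k)) := by
  have hle : LinearMap.range (N ^ r) ≤ LinearMap.range (N ^ k) := by
    rw [← Nat.add_sub_cancel' hk, pow_add]
    exact LinearMap.range_comp_le_range _ _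
  have hrange : LinearMap.range (N.domRestrict (LinearMap.range (N ^ k))) =
      LinearMap.range (N ^ (k + 1)) := by
    rw [LinearMap.range_domRestrict, pow_succ', Module.End.mul_eq_comp, LinearMap.range_comp]
  have hker : (LinearMap.range (N ^ r)).comap (LinearMap.range (N ^ k)).subtype ≤
      LinearMap.ker (N.domRestrict (LinearMap.range (N ^ k))) := by
    rintro ⟨x, hx⟩ ⟨y, rfl⟩
    have h := LinearMap.congr_fun hN y
    rw [pow_succ'] at h
    exact h
  have hrank := (N.domRestrict (LinearMap.range (N ^ k))).finrank_range_add_finrank_ker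
  rw [hrange] at hrank
  have hdim := Submodule.finrank_mono hker
  rw [(Submodule.comapSubtypeEquivOfLe hle).finrank_eq] at hdim
  omega

/-- If `N ^ (r + 1) = 0` then `(r + 1) · dim (range N^r) ≤ dim V`: each Jordan block of
size exactly `r + 1` contributes `r + 1` to the dimension of `V`. -/
theorem rank_range_pow_le (K V : Type*) [Field K] [AddCommGroup V] [Module K V]
    [FiniteDimensional K V] (r : ℕ) (N : V →ₗ[K] V) (hN : N ^ (r + 1) = 0) :
    (r + 1) * finrank K (LinearMap.range (N ^ r)) ≤ finrank K V := by
  have key : ∀ j ≤ r + 1, j * finrank K (LinearMap.range (N ^ r)) +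
      finrank K (LinearMap.range (N ^ j)) ≤ finrank K V := by
    intro j
    induction j with
    | zero => intro _; simpa using Submodule.finrank_le (LinearMap.range (N ^ 0))
    | succ j ih =>
      intro hj
      have hprev := ih (by omega)
      have hstep := finrank_range_pow_succ_add_le hN (Nat.le_of_succ_le_succ hj)
      rw [add_mul, one_mul]
      omega
  exact (Nat.le_add_right _ _).trans (key (r + 1) le_rfl)
end

section
/- Let K be a field, V a finite-dimensional K-vector space, r a natural number, and N : V → V a K-linear endomorphism with N^{r+1} = 0. Let (V_i)_{i ∈ ℤ} be a monodromy filtration for (V, N, r+1). Then the bottom piece V_{-r} equals the image of N^r. -/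
/-- The bottom piece `F (-r)` of the monodromy filtration for `(V, N, r + 1)` equals
the image of `N ^ r`. -/
theorem monodromyFiltration_bottom_eq_range (K V : Type*) [Field K] [AddCommGroup V]
    [Module K V] [FiniteDimensional K V] (r : ℕ) (N : V →ₗ[K] V) (hN : N ^ (r + 1) = 0)
    (F : ℤ → Submodule K V) (hF : IsMonodromyFiltration N (r + 1) F) :
    F (-(r : ℤ)) = LinearMap.range (N ^ r) := by
  obtain ⟨-, htop, hbot, -, hgr⟩ := hF
  have mem_F (x : V) : x ∈ F (r : ℤ) := by
    have h := (hgr (r + 1)).2.1 x (htop ▸ Submodule.mem_top) (by simp [hN])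
    simpa using h
  have hbot' : F (-(r : ℤ) - 1) = ⊥ := by
    rw [← hbot]
    congr 1
    push_cast
    ring
  obtain ⟨hmaps, -, hsurj⟩ := hgr r
  ext y
  refine ⟨fun hy => ?_, ?_⟩
  · obtain ⟨x, -, hx⟩ := hsurj y hy
    rw [hbot', Submodule.mem_bot, sub_eq_zero] at hx
    exact ⟨x, hx.symm⟩
  · rintro ⟨x, rfl⟩
    exact hmaps x (mem_F x)
end

section
/- Let n be a natural number and l a positive integer. Let P ⊆ ℝⁿ be a nonempty convex set containing a lattice point w₀ ∈ P ∩ ℤⁿ, and let Q ⊆ ℝⁿ be a convex cone with 0 ∈ Q. In ℝⁿ × ℝ define P̃ = {(t • x, t·l) : t ≥ 0, x ∈ P} (the cone over P × {l}) and Q' = Q × {0}. For a nonempty convex subset S of ℝ^k and a point w ∈ S, write N_S for the subgroup ℤ^k ∩ span_ℝ(S − w) (for P̃, Q', and Q take w = 0; for P and P + Q take w = w₀). If N_{P̃} + N_{Q'} = N_{P̃ + Q'} as subgroups of ℤ^{n+1} (where P̃ + Q' is the Minkowski sum), then N_P + N_Q = N_{P+Q} as subgroups of ℤⁿ. -/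
open Pointwise

/-- For a convex set `S ⊆ ℝᵏ` with base point `w`, the subgroup
`N_S = ℤᵏ ∩ span_ℝ (S - w)` of lattice vectors in the real span of `S - w`. -/
def latticeSpan {k : ℕ} (S : Set (Fin k → ℝ)) (w : Fin k → ℝ) : Set (Fin k → ℤ) :=
  {v : Fin k → ℤ | (fun i => (v i : ℝ)) ∈ Submodule.span ℝ ((fun s => s - w) '' S)}

/-- The analogous subgroup of the lattice `ℤⁿ × ℤ` in `ℝⁿ × ℝ`, with base point `0`. -/
def latticeSpanProd {n : ℕ} (S : Set ((Fin n → ℝ) × ℝ)) : Set ((Fin n → ℤ) × ℤ) :=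
  {v : (Fin n → ℤ) × ℤ |
    (((fun i => (v.1 i : ℝ)), (v.2 : ℝ)) : (Fin n → ℝ) × ℝ) ∈ Submodule.span ℝ S}

/-- If `N_{P̃} + N_{Q'} = N_{P̃ + Q'}` for the cone `P̃` over `P × {l}` and `Q' = Q × {0}`
in `ℝⁿ × ℝ`, then `N_P + N_Q = N_{P + Q}` in `ℤⁿ`. -/
theorem latticeSpan_add_of_cone (n : ℕ) (l : ℕ) (hl : 0 < l)
    (P Q : Set (Fin n → ℝ)) (hPconv : Convex ℝ P)
    (w₀ : Fin n → ℤ) (hw₀ : (fun i => (w₀ i : ℝ)) ∈ P)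
    (hQconv : Convex ℝ Q)
    (hQcone : ∀ c : ℝ, 0 ≤ c → ∀ x ∈ Q, c • x ∈ Q)
    (hQ0 : (0 : Fin n → ℝ) ∈ Q)
    (Ptilde : Set ((Fin n → ℝ) × ℝ))
    (hPt : Ptilde = {p : (Fin n → ℝ) × ℝ |
      ∃ t : ℝ, 0 ≤ t ∧ ∃ x ∈ P, p = (t • x, t * (l : ℝ))})
    (Q' : Set ((Fin n → ℝ) × ℝ)) (hQ' : Q' = Q ×ˢ ({0} : Set ℝ))
    (hyp : latticeSpanProd Ptilde + latticeSpanProd Q' = latticeSpanProd (Ptilde + Q')) :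
    latticeSpan P (fun i => (w₀ i : ℝ)) + latticeSpan Q 0 =
      latticeSpan (P + Q) (fun i => (w₀ i : ℝ)) := by
  set w : Fin n → ℝ := fun i => (w₀ i : ℝ) with hw
  have hl' : (l : ℝ) ≠ 0 := by exact_mod_cast hl.ne'
  apply Set.Subset.antisymm
  · rintro _ ⟨a, ha, b, hb, rfl⟩
    have h₁ : Submodule.span ℝ ((fun s => s - w) '' P) ≤
        Submodule.span ℝ ((fun s => s - w) '' (P + Q)) := by
      apply Submodule.span_mono
      rintro _ ⟨x, hx, rfl⟩
      exact ⟨x, ⟨x, hx, 0, hQ0, add_zero x⟩, rfl⟩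
    have h₂ : Submodule.span ℝ ((fun s => s - 0) '' Q) ≤
        Submodule.span ℝ ((fun s => s - w) '' (P + Q)) := by
      apply Submodule.span_mono
      rintro _ ⟨q, hq, rfl⟩
      exact ⟨w + q, Set.add_mem_add hw₀ hq, by simp⟩
    have h := add_mem (h₁ ha) (h₂ hb)
    show (fun i => (((a + b) i : ℤ) : ℝ)) ∈ Submodule.span ℝ ((fun s => s - w) '' (P + Q))
    convert h using 1
    ext i
    simp
  · intro v hv
    have hinl : Submodule.span ℝ ((fun s => s - w) '' (P + Q)) ≤
        (Submodule.span ℝ (Ptilde + Q')).comap (LinearMap.inl ℝ (Fin n → ℝ) ℝ) := by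
      rw [Submodule.span_le]
      rintro _ ⟨_, ⟨x, hx, q, hq, rfl⟩, rfl⟩
      have hmem : ∀ y ∈ P, ∀ r ∈ Q, ((y + r, (l : ℝ)) : (Fin n → ℝ) × ℝ) ∈
          Submodule.span ℝ (Ptilde + Q') := by
        intro y hy r hr
        apply Submodule.subset_span
        subst hPt hQ'
        exact ⟨(y, l), ⟨1, zero_le_one, y, hy, by simp⟩, (r, 0), ⟨hr, rfl⟩, by simp⟩
      have h := sub_mem (hmem x hx q hq) (hmem w hw₀ 0 hQ0)
      simpa using h
    have hv' : ((v, 0) : (Fin n → ℤ) × ℤ) ∈ latticeSpanProd (Ptilde + Q') := by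
      simpa [latticeSpanProd] using hinl hv
    rw [← hyp] at hv'
    obtain ⟨a, ha, b, hb, hab⟩ := hv'
    have hfst : Submodule.span ℝ Q' ≤
        ((Submodule.span ℝ ((fun s => s - 0) '' Q)).prod ⊥) := by
      rw [Submodule.span_le, hQ']
      rintro ⟨q, s⟩ ⟨hq, hs⟩
      exact ⟨Submodule.subset_span ⟨q, hq, sub_zero q⟩, hs⟩
    have hproj : Submodule.span ℝ Ptilde ≤
        (Submodule.span ℝ ((fun s => s - w) '' P)).comap
          (LinearMap.fst ℝ (Fin n → ℝ) ℝ -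
            (LinearMap.snd ℝ (Fin n → ℝ) ℝ).smulRight ((l : ℝ)⁻¹ • w)) := by
      rw [Submodule.span_le, hPt]
      rintro _ ⟨t, -, x, hx, rfl⟩
      have h := Submodule.smul_mem _ t (Submodule.subset_span (R := ℝ)
        (Set.mem_image_of_mem (fun s => s - w) hx))
      simpa [smul_smul, smul_sub, mul_assoc, hl'] using h
    obtain ⟨hb₁, hb₂⟩ := hfst hb
    have hb0 : b.2 = 0 := by simpa using hb₂
    have ha0 : a.2 = 0 := by
      have h := congrArg Prod.snd hab
      simpa [hb0] using h
    refine ⟨a.1, ?_, b.1, hb₁, congrArg Prod.fst hab⟩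
    have h := hproj ha
    simpa [ha0, latticeSpan] using h
end
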